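/- Let λ, λ̂ ∈ (0,1) and define the Borel measure ν := (1/2)(S₀)_* ν_λ + (1/2)(S₁)_* ν_{λ̂} on ℝ, where S₀(x) = x/3 and S₁(x) = (x+2)/3. Then ν is a probability measure concentrated on K which is doubling on K: there exists C ≥ 1 such that ν(B(x,2r)) ≤ C ν(B(x,r)) for every x ∈ K and every r > 0. -/

import Mathlib

open MeasureTheory Filter Set Metric
open scoped ENNReal Topology

noncomputable section

/-- The map `π : Σ = {0,1}^ℕ → ℝ` (with `false` representing the digit 0 and `true`
representing the digit 1, coordinates indexed from 0), `π(a) = ∑_{i} 2 aᵢ 3^{-(i+1)}`. -/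
def cantorPi (a : ℕ → Bool) : ℝ := ∑' i : ℕ, (if a i then 2 else 0) / 3 ^ (i + 1)

/-- The middle-third Cantor set `K = π(Σ)`. -/
def cantorK : Set ℝ := Set.range cantorPi

/-- The similar copy `K_a` of `K` determined by a finite binary string `a` of length `N`. -/
def cantorCyl {N : ℕ} (a : Fin N → Bool) : Set ℝ :=
  cantorPi '' {b : ℕ → Bool | ∀ i : Fin N, b i = a i}

/-- The number of zeros in the finite binary string `a`. -/
def zeros {N : ℕ} (a : Fin N → Bool) : ℕ := (Finset.univ.filter fun i => a i = false).card

/-- One step of the Bernoulli(w) shift map on `[0,1)`. -/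
def bernStep (w x : ℝ) : ℝ := if x < w then x / w else (x - w) / (1 - w)

/-- The Bernoulli(w) digit sequence of `x ∈ [0,1)`: digit `n` is `false` (i.e. 0)
iff the `n`-th iterate of the Bernoulli shift lies in `[0,w)`. -/
def bernDigits (w x : ℝ) : ℕ → Bool := fun n => decide (w ≤ (bernStep w)^[n] x)

/-- The Bernoulli product probability measure `ν_{w,Σ}` on `Σ = {0,1}^ℕ`, under which the
coordinates are i.i.d. with mass `w` on 0 (= `false`) and mass `1-w` on 1 (= `true`);
realized as the law of the Bernoulli(w) digit sequence of a uniform point of `[0,1)`. -/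
def bernMeasure (w : ℝ) : Measure (ℕ → Bool) :=
  Measure.map (bernDigits w) (volume.restrict (Set.Ico (0:ℝ) 1))

/-- The measure `ν_w = π_* ν_{w,Σ}` on `ℝ`, concentrated on `K`. -/
def nu (w : ℝ) : Measure ℝ := (bernMeasure w).map cantorPi

/-- The contraction `x ↦ (x + 2b) / 3` attached to the digit `b`. -/
def cantorMap (b : Bool) (x : ℝ) : ℝ := (x + if b then 2 else 0) / 3

lemma measurable_cantorMap (b : Bool) : Measurable (cantorMap b) := by
  unfold cantorMap; fun_prop

lemma cantorPi_term_nonneg (a : ℕ → Bool) (i : ℕ) :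
    (0 : ℝ) ≤ (if a i then 2 else 0) / 3 ^ (i + 1) := by
  split_ifs <;> positivity

lemma cantorPi_term_le (a : ℕ → Bool) (i : ℕ) :
    (if a i then 2 else 0) / 3 ^ (i + 1) ≤ (2 / 3 : ℝ) * (1 / 3) ^ i := by
  have h : (2 / 3 : ℝ) * (1 / 3) ^ i = 2 / 3 ^ (i + 1) := by
    rw [one_div, inv_pow, pow_succ]; field_simp
  rw [h]
  gcongr
  split_ifs <;> norm_num

lemma summable_cantorPi_bound : Summable fun i : ℕ => (2 / 3 : ℝ) * (1 / 3) ^ i :=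
  (summable_geometric_of_lt_one (by norm_num) (by norm_num)).mul_left _

lemma summable_cantorPi (a : ℕ → Bool) :
    Summable fun i : ℕ => (if a i then (2 : ℝ) else 0) / 3 ^ (i + 1) :=
  .of_nonneg_of_le (cantorPi_term_nonneg a) (cantorPi_term_le a) summable_cantorPi_bound

lemma cantorPi_mem_Icc (a : ℕ → Bool) : cantorPi a ∈ Icc (0 : ℝ) 1 := by
  refine ⟨tsum_nonneg (cantorPi_term_nonneg a), ?_⟩
  refine ((summable_cantorPi a).tsum_le_tsum (cantorPi_term_le a)
    summable_cantorPi_bound).trans ?_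
  rw [tsum_mul_left, tsum_geometric_of_lt_one (by norm_num) (by norm_num)]
  norm_num

lemma continuous_cantorPi : Continuous cantorPi := by
  refine continuous_tsum (fun i => ?_) summable_cantorPi_bound fun i a => ?_
  · have h : Continuous fun b : Bool => (if b then (2 : ℝ) else 0) / 3 ^ (i + 1) :=
      continuous_of_discreteTopology
    exact h.comp (continuous_apply i)
  · rw [Real.norm_of_nonneg (cantorPi_term_nonneg a i)]
    exact cantorPi_term_le a i

lemma cantorPi_eq_cantorMap (a : ℕ → Bool) :
    cantorPi a = cantorMap (a 0) (cantorPi fun n => a (n + 1)) := by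
  rw [cantorPi, (summable_cantorPi a).tsum_eq_zero_add, cantorMap, cantorPi, add_div, add_comm,
    ← tsum_div_const]
  congr 1
  · exact tsum_congr fun i => by rw [pow_succ _ (i + 1), div_div]
  · simp

lemma isClosed_cantorK : IsClosed cantorK :=
  (isCompact_range continuous_cantorPi).isClosed

lemma cantorK_subset_Icc : cantorK ⊆ Icc 0 1 := by
  rintro _ ⟨a, rfl⟩
  exact cantorPi_mem_Icc a

lemma exists_cantorMap_eq {x : ℝ} (hx : x ∈ cantorK) :
    ∃ b, ∃ y ∈ cantorK, x = cantorMap b y := by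
  obtain ⟨a, rfl⟩ := hx
  exact ⟨_, _, ⟨_, rfl⟩, cantorPi_eq_cantorMap a⟩

lemma cantorMap_mem_cantorK (b : Bool) {x : ℝ} (hx : x ∈ cantorK) : cantorMap b x ∈ cantorK := by
  obtain ⟨a, rfl⟩ := hx
  refine ⟨fun n => Nat.casesOn n b a, ?_⟩
  exact cantorPi_eq_cantorMap _

lemma measurable_bernStep (w : ℝ) : Measurable (bernStep w) :=
  Measurable.ite measurableSet_Iio (by fun_prop) (by fun_prop)

lemma measurable_bernDigits (w : ℝ) : Measurable (bernDigits w) := by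
  refine measurable_pi_lambda _ fun n => measurable_to_bool ?_
  have h : (fun x => bernDigits w x n) ⁻¹' {true} = (bernStep w)^[n] ⁻¹' Ici w := by
    ext x; simp [bernDigits]
  rw [h]
  exact (measurable_bernStep w).iterate n measurableSet_Ici

lemma nu_apply (w : ℝ) {E : Set ℝ} (hE : MeasurableSet E) :
    nu w E = volume ((fun x => cantorPi (bernDigits w x)) ⁻¹' E ∩ Ico 0 1) := by
  rw [nu, Measure.map_apply continuous_cantorPi.measurable hE, bernMeasure,
    Measure.map_apply (measurable_bernDigits w) (continuous_cantorPi.measurable hE),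
    Measure.restrict_apply (measurable_bernDigits w (continuous_cantorPi.measurable hE))]
  rfl

instance isProbabilityMeasure_nu (w : ℝ) : IsProbabilityMeasure (nu w) :=
  ⟨by simp [nu_apply w MeasurableSet.univ]⟩

lemma nu_compl_cantorK (w : ℝ) : nu w cantorKᶜ = 0 := by
  rw [nu_apply w isClosed_cantorK.measurableSet.compl]
  convert measure_empty (μ := volume)
  ext x
  simp [cantorK]

lemma cantorPi_bernDigits (w x : ℝ) : cantorPi (bernDigits w x) =
    cantorMap (decide (w ≤ x)) (cantorPi (bernDigits w (bernStep w x))) := by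
  exact cantorPi_eq_cantorMap (bernDigits w x)

lemma volume_preimage_sub_mul {c d : ℝ} (hd : 0 < d) (s : Set ℝ) :
    volume ((fun x => (x - c) / d) ⁻¹' s) = ENNReal.ofReal d * volume s := by
  have h : (fun x => (x - c) / d) ⁻¹' s =
      (fun x => x + -c) ⁻¹' ((fun x => x * d⁻¹) ⁻¹' s) := by
    simp only [preimage_preimage, sub_eq_add_neg, div_eq_mul_inv]
  rw [h, measure_preimage_add_right, Real.volume_preimage_mul_right (inv_ne_zero hd.ne'),
    inv_inv, abs_of_pos hd]

/-- `ν` is the mixture of the images of the measures `m b`, `b ∈ {0,1}`, under the contractions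
`cantorMap b`, with weights `p b`. -/
def IsCantorMixture (p : Bool → ℝ≥0∞) (m : Bool → Measure ℝ) (ν : Measure ℝ) : Prop :=
  ∀ E, MeasurableSet E → ν E = p false * m false (cantorMap false ⁻¹' E) +
    p true * m true (cantorMap true ⁻¹' E)

lemma isCantorMixture_nu {w : ℝ} (hw : w ∈ Ioo (0 : ℝ) 1) :
    IsCantorMixture (fun b => ENNReal.ofReal (bif b then 1 - w else w)) (fun _ => nu w)
      (nu w) := by
  intro E hE
  obtain ⟨h0, h1⟩ := hw
  have h1' : 0 < 1 - w := by linarith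
  rw [nu_apply w hE, nu_apply w (measurable_cantorMap _ hE),
    nu_apply w (measurable_cantorMap _ hE)]
  simp only [cond_true, cond_false]
  rw [← volume_preimage_sub_mul (c := 0) h0, ← volume_preimage_sub_mul (c := w) h1',
    ← measure_inter_add_sdiff _ (measurableSet_Iio (a := w))]
  congr 2
  · ext x
    simp only [mem_inter_iff, mem_preimage, mem_Ico, mem_Iio, sub_zero]
    rw [cantorPi_bernDigits w x]
    by_cases hx : x < w
    · have : decide (w ≤ x) = false := by simpa using hx
      rw [this, bernStep, if_pos hx, div_lt_one h0, le_div_iff₀ h0, zero_mul]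
      constructor
      · rintro ⟨⟨a, b, c⟩, d⟩; exact ⟨a, b, d⟩
      · rintro ⟨a, b, d⟩; exact ⟨⟨a, b, by linarith⟩, d⟩
    · rw [div_lt_one h0]; tauto
  · ext x
    simp only [mem_inter_iff, Set.mem_sdiff, mem_preimage, mem_Ico, mem_Iio, not_lt]
    rw [cantorPi_bernDigits w x, div_lt_one h1', le_div_iff₀ h1', zero_mul, sub_nonneg, sub_lt_sub_iff_right]
    by_cases hx : w ≤ x
    · have : decide (w ≤ x) = true := by simpa using hx
      rw [this, bernStep, if_neg hx.not_gt]
      constructor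
      · rintro ⟨⟨a, b, c⟩, d⟩; exact ⟨a, d, c⟩
      · rintro ⟨a, b, d⟩; exact ⟨⟨a, by linarith, d⟩, b⟩
    · tauto

lemma cantorMap_preimage_ball (b : Bool) (y r : ℝ) :
    cantorMap b ⁻¹' ball (cantorMap b y) r = ball y (3 * r) := by
  ext z
  have h : cantorMap b z - cantorMap b y = (z - y) / 3 := by unfold cantorMap; ring
  rw [mem_preimage, mem_ball, mem_ball, Real.dist_eq, Real.dist_eq, h, abs_div,
    abs_of_pos (by norm_num : (0 : ℝ) < 3), div_lt_iff₀ (by norm_num), mul_comm r]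

/-- The preimage of a small ball around a point of one half of `K` under the contraction onto
the other half misses `K`. -/
lemma cantorMap_not_preimage_ball_subset (b : Bool) {y r : ℝ} (hy : y ∈ cantorK)
    (hr : r ≤ 1 / 3) : cantorMap (!b) ⁻¹' ball (cantorMap b y) r ⊆ cantorKᶜ := by
  intro z hz hzK
  obtain ⟨hy0, hy1⟩ := cantorK_subset_Icc hy
  obtain ⟨hz0, hz1⟩ := cantorK_subset_Icc hzK
  rw [mem_preimage, mem_ball, Real.dist_eq, abs_lt] at hz
  obtain ⟨h, h'⟩ := hz
  cases b <;> simp [cantorMap] at h h' <;> linarith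

section Doubling

variable {p : Bool → ℝ≥0∞} {m : Bool → Measure ℝ} {ν : Measure ℝ}

lemma IsCantorMixture.le_ball (h : IsCantorMixture p m ν) (b : Bool) (y r : ℝ) :
    p b * m b (ball y (3 * r)) ≤ ν (ball (cantorMap b y) r) := by
  rw [h _ measurableSet_ball, ← cantorMap_preimage_ball b]
  cases b
  · exact le_self_add
  · exact le_add_self

lemma IsCantorMixture.ball_eq (h : IsCantorMixture p m ν) (hm : ∀ b, m b cantorKᶜ = 0)
    (b : Bool) {y r : ℝ} (hy : y ∈ cantorK) (hr : r ≤ 1 / 3) :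
    ν (ball (cantorMap b y) r) = p b * m b (ball y (3 * r)) := by
  have h0 := measure_mono_null (cantorMap_not_preimage_ball_subset b hy hr) (hm (!b))
  rw [h _ measurableSet_ball, ← cantorMap_preimage_ball b]
  cases b <;> simp_all

lemma IsCantorMixture.ball_two_mul_le (h : IsCantorMixture p m ν) (hm : ∀ b, m b cantorKᶜ = 0)
    (b : Bool) {y r : ℝ} (hy : y ∈ cantorK) (hr : r ≤ 1 / 6) {C : ℝ≥0∞}
    (hC : m b (ball y (2 * (3 * r))) ≤ C * m b (ball y (3 * r))) :
    ν (ball (cantorMap b y) (2 * r)) ≤ C * ν (ball (cantorMap b y) r) := by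
  rw [h.ball_eq hm b hy (by linarith), mul_left_comm 3 2 r]
  calc p b * m b (ball y (2 * (3 * r))) ≤ p b * (C * m b (ball y (3 * r))) := by gcongr
    _ = C * (p b * m b (ball y (3 * r))) := mul_left_comm _ _ _
    _ ≤ C * ν (ball (cantorMap b y) r) := by gcongr; exact h.le_ball b y r

end Doubling

lemma measure_ball_eq_one {μ : Measure ℝ} [IsProbabilityMeasure μ] (hμ : μ cantorKᶜ = 0) {x r : ℝ}
    (hx : x ∈ cantorK) (hr : 1 < r) : μ (ball x r) = 1 := by
  rw [← prob_compl_eq_zero_iff measurableSet_ball]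
  refine measure_mono_null (compl_subset_compl.2 fun z hz => ?_) hμ
  obtain ⟨hx0, hx1⟩ := cantorK_subset_Icc hx
  obtain ⟨hz0, hz1⟩ := cantorK_subset_Icc hz
  rw [mem_ball, Real.dist_eq, abs_lt]
  constructor <;> linarith

lemma exists_le_nu_ball {w : ℝ} (hw : w ∈ Ioo (0 : ℝ) 1) :
    ∃ c : ℝ≥0∞, c ≠ 0 ∧ ∀ x ∈ cantorK, ∀ r : ℝ, 1 / 6 < r → c ≤ nu w (ball x r) := by
  set p : Bool → ℝ≥0∞ := fun b => ENNReal.ofReal (bif b then 1 - w else w) with hp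
  have h : IsCantorMixture p _ _ := isCantorMixture_nu hw
  have hmin : min (p false) (p true) ≠ 0 := by
    have := hw.1
    have := hw.2
    simp [min_eq_iff, *]
  have hle : ∀ b, min (p false) (p true) ≤ p b := by
    rintro (_ | _)
    exacts [min_le_left _ _, min_le_right _ _]
  refine ⟨min (p false) (p true) * min (p false) (p true), mul_ne_zero hmin hmin,
    fun x hx r hr => ?_⟩
  obtain ⟨b, y, hy, rfl⟩ := exists_cantorMap_eq hx
  obtain ⟨b', z, hz, rfl⟩ := exists_cantorMap_eq hy
  refine (mul_le_mul' (hle b) ?_).trans (h.le_ball b _ r)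
  refine le_trans ?_ (h.le_ball b' z (3 * r))
  rw [measure_ball_eq_one (nu_compl_cantorK w) hz (by linarith), mul_one]
  exact hle b'

lemma le_inv_mul_of_le {a b c : ℝ≥0∞} (ha : a ≤ 1) (hb : b ≤ 1) (hc : c ≠ 0) (h : c ≤ b) :
    a ≤ c⁻¹ * b := by
  refine ha.trans ?_
  rw [← ENNReal.inv_mul_cancel hc (ne_top_of_le_ne_top ENNReal.one_ne_top (h.trans hb))]
  gcongr

/-- The Bernoulli measures on `K` are doubling on `K`. -/
lemma nu_doubling {w : ℝ} (hw : w ∈ Ioo (0 : ℝ) 1) :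
    ∃ C : ℝ≥0∞, C ≠ ∞ ∧ ∀ x ∈ cantorK, ∀ r : ℝ, 0 < r →
      nu w (ball x (2 * r)) ≤ C * nu w (ball x r) := by
  obtain ⟨c, hc, hle⟩ := exists_le_nu_ball hw
  refine ⟨c⁻¹, ENNReal.inv_ne_top.2 hc, fun x hx r hr => ?_⟩
  have key : ∀ n : ℕ, ∀ x ∈ cantorK, ∀ r : ℝ, 1 / 6 < 3 ^ n * r →
      nu w (ball x (2 * r)) ≤ c⁻¹ * nu w (ball x r) := by
    intro n
    induction n with
    | zero =>
      intro x hx r hr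
      exact le_inv_mul_of_le prob_le_one prob_le_one hc (hle x hx r (by simpa using hr))
    | succ n ih =>
      intro x hx r hr
      rcases lt_or_ge (1 / 6) r with hr' | hr'
      · exact le_inv_mul_of_le prob_le_one prob_le_one hc (hle x hx r hr')
      · obtain ⟨b, y, hy, rfl⟩ := exists_cantorMap_eq hx
        refine (isCantorMixture_nu hw).ball_two_mul_le (fun _ => nu_compl_cantorK w) b hy hr'
          (ih y hy _ ?_)
        rwa [pow_succ, mul_assoc] at hr
  obtain ⟨n, hn⟩ := pow_unbounded_of_one_lt (1 / 6 / r) (by norm_num : (1 : ℝ) < 3)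
  exact key n x hx r ((div_lt_iff₀ hr).1 hn)

/-- Let `λ, λ̂ ∈ (0,1)` and let `ν := (1/2)(S₀)_* ν_λ + (1/2)(S₁)_* ν_{λ̂}` where
`S₀(x) = x/3` and `S₁(x) = (x+2)/3`. Then `ν` is a probability measure concentrated on `K`
which is doubling on `K`. -/
theorem mixed_measure_doubling (lam lamh : ℝ) (hlam : lam ∈ Set.Ioo (0:ℝ) 1)
    (hlamh : lamh ∈ Set.Ioo (0:ℝ) 1) (ν : Measure ℝ)
    (hν : ν = (2 : ℝ≥0∞)⁻¹ • Measure.map (fun x : ℝ => x / 3) (nu lam) +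
      (2 : ℝ≥0∞)⁻¹ • Measure.map (fun x : ℝ => (x + 2) / 3) (nu lamh)) :
    IsProbabilityMeasure ν ∧ ν cantorKᶜ = 0 ∧
      ∃ C : ℝ, 1 ≤ C ∧ ∀ x ∈ cantorK, ∀ r : ℝ, 0 < r →
        ν (Metric.ball x (2 * r)) ≤ ENNReal.ofReal C * ν (Metric.ball x r) := by
  have hmix : IsCantorMixture (fun _ => 2⁻¹) (fun b => nu (bif b then lamh else lam)) ν := by
    intro E hE
    have h0 : (fun x : ℝ => x / 3) = cantorMap false := by ext x; simp [cantorMap]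
    have h1 : (fun x : ℝ => (x + 2) / 3) = cantorMap true := by ext x; simp [cantorMap]
    rw [hν, h0, h1, Measure.add_apply, Measure.smul_apply, Measure.smul_apply,
      Measure.map_apply (measurable_cantorMap _) hE, Measure.map_apply (measurable_cantorMap _) hE]
    rfl
  have hprob : IsProbabilityMeasure ν :=
    ⟨by simp [hmix _ MeasurableSet.univ, ENNReal.inv_two_add_inv_two]⟩
  refine ⟨hprob, ?_, ?_⟩
  · have h (w : ℝ) (b : Bool) : nu w (cantorMap b ⁻¹' cantorKᶜ) = 0 :=
      measure_mono_null (fun x hx hxK => hx (cantorMap_mem_cantorK b hxK)) (nu_compl_cantorK w)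
    rw [hmix _ isClosed_cantorK.measurableSet.compl, h, h, mul_zero, add_zero]
  have hmem : ∀ b : Bool, (bif b then lamh else lam) ∈ Ioo (0 : ℝ) 1 := by
    rintro (_ | _) <;> assumption
  choose D hD hdoub using fun b => nu_doubling (hmem b)
  choose c hc hle using fun b => exists_le_nu_ball (hmem b)
  set M : ℝ≥0∞ := 1 + ∑ b, (D b + (2⁻¹ * c b)⁻¹) with hM
  have hc' : ∀ b, 2⁻¹ * c b ≠ 0 := fun b => mul_ne_zero (by simp) (hc b)
  have hMtop : M ≠ ∞ :=
    ENNReal.add_ne_top.2 ⟨ENNReal.one_ne_top, ENNReal.sum_ne_top.2 fun b _ =>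
      ENNReal.add_ne_top.2 ⟨hD b, ENNReal.inv_ne_top.2 (hc' b)⟩⟩
  have hbM : ∀ b, D b + (2⁻¹ * c b)⁻¹ ≤ M := fun b =>
    (Finset.single_le_sum (f := fun b => D b + (2⁻¹ * c b)⁻¹) (fun _ _ => zero_le)
      (Finset.mem_univ b)).trans le_add_self
  refine ⟨M.toReal, ?_, fun x hx r hr => ?_⟩
  · rw [← ENNReal.toReal_one]
    exact ENNReal.toReal_mono hMtop le_self_add
  rw [ENNReal.ofReal_toReal hMtop]
  obtain ⟨b, y, hy, rfl⟩ := exists_cantorMap_eq hx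
  rcases lt_or_ge (1 / 6) r with hr' | hr'
  · refine (le_inv_mul_of_le prob_le_one prob_le_one (hc' b) ?_).trans
      (mul_le_mul_left (le_add_self.trans (hbM b)) _)
    refine le_trans ?_ (hmix.le_ball b y r)
    gcongr
    exact hle b y hy _ (by linarith)
  · exact hmix.ball_two_mul_le (fun _ => nu_compl_cantorK _) b hy hr'
      ((hdoub b y hy _ (by linarith)).trans (mul_le_mul_left (le_self_add.trans (hbM b)) _))
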